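/- Let A be a countable simple von Neumann regular ring which is not right Noetherian, and let Q be an injective cogenerator of Mod-A containing an isomorphic copy of every cyclic right A-module. Then Ext^1_A(Q, Q^{(ℕ)}) ≠ 0, where Q^{(ℕ)} denotes the countable direct sum of copies of Q. -/

import Mathlib

/-- `Ext¹_R(X, N) ≠ 0`, expressed by the existence of a non-split extension
`0 → N → E → X → 0` of `R`-modules. -/
def Ext1Nonzero (R : Type) [Ring R] (X N : Type) [AddCommGroup X] [Module R X]
    [AddCommGroup N] [Module R N] : Prop :=
  ∃ (E : Type) (_ : AddCommGroup E) (_ : Module R E) (f : N →ₗ[R] E) (g : E →ₗ[R] X),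
    Function.Injective f ∧ Function.Surjective g ∧
    LinearMap.range f = LinearMap.ker g ∧
    ¬ ∃ s : X →ₗ[R] E, g.comp s = LinearMap.id

/-- In a von Neumann regular ring, every element `a` of a left ideal `J` and every idempotent
`e ∈ J` are fixed by right multiplication by a common idempotent of `J`. -/
lemma exists_idempotent_extending {R : Type*} [Ring R]
    (hvnr : ∀ a : R, ∃ x : R, a * x * a = a) (J : Ideal R) {e a : R} (he : e ∈ J)
    (hee : e * e = e) (ha : a ∈ J) :
    ∃ e' ∈ J, e' * e' = e' ∧ e * e' = e ∧ a * e' = a := by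
  obtain ⟨x, hx⟩ := hvnr (a - a * e)
  set f := x * (a - a * e) with hf
  have hfJ : f ∈ J := J.mul_mem_left _ (J.sub_mem ha (J.mul_mem_left _ he))
  have hfe : f * e = 0 := by
    rw [hf, mul_assoc, sub_mul, mul_assoc a, hee, sub_self, mul_zero]
  have hbf : (a - a * e) * f = a - a * e := by rw [hf, ← mul_assoc, hx]
  have hff : f * f = f := by
    conv_lhs => rw [hf, mul_assoc, hbf]
  clear_value f
  refine ⟨e + f - e * f, J.sub_mem (J.add_mem he hfJ) (J.mul_mem_left _ hfJ), ?_, ?_, ?_⟩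
  · have h1 : e * (e + f - e * f) = e := by
      rw [mul_sub, mul_add, ← mul_assoc, hee]; abel
    have h2 : f * (e + f - e * f) = f := by
      rw [mul_sub, mul_add, ← mul_assoc, hfe, hff]; simp
    rw [sub_mul, add_mul, mul_assoc e f, h1, h2]
  · rw [mul_sub, mul_add, ← mul_assoc, hee]; abel
  · calc a * (e + f - e * f) = a * e + (a - a * e) * f := by noncomm_ring
      _ = a := by rw [hbf]; abel

/-- A left ideal of a countable von Neumann regular ring is the union of an ascending sequence
of principal left ideals generated by idempotents. -/
lemma exists_idempotent_sequence {R : Type*} [Ring R] [Countable R]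
    (hvnr : ∀ a : R, ∃ x : R, a * x * a = a) (J : Ideal R) :
    ∃ e : ℕ → R, (∀ n, e n ∈ J) ∧ (∀ n, e n * e n = e n) ∧ (∀ n, e n * e (n + 1) = e n) ∧
      ∀ a ∈ J, ∃ n, a * e n = a := by
  obtain ⟨u, hu⟩ := exists_surjective_nat J
  have step : ∀ (p : {e : R // e ∈ J ∧ e * e = e}) (n : ℕ),
      ∃ q : {e : R // e ∈ J ∧ e * e = e}, p.1 * q.1 = p.1 ∧ (u n : R) * q.1 = u n := by
    rintro ⟨e, he, hee⟩ n
    obtain ⟨e', h1, h2, h3, h4⟩ := exists_idempotent_extending hvnr J he hee (u n).2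
    exact ⟨⟨e', h1, h2⟩, h3, h4⟩
  choose next hnext hfix using step
  let s : ℕ → {e : R // e ∈ J ∧ e * e = e} :=
    fun n => Nat.rec ⟨0, J.zero_mem, mul_zero 0⟩ (fun n p => next p n) n
  refine ⟨fun n => (s n).1, fun n => (s n).2.1, fun n => (s n).2.2, fun n => hnext (s n) n, ?_⟩
  intro a ha
  obtain ⟨n, hn⟩ := hu ⟨a, ha⟩
  refine ⟨n + 1, ?_⟩
  have := hfix (s n) n
  rwa [hn] at this

lemma mul_eq_self_of_le {R : Type*} [Ring R] {e : ℕ → R} (he : ∀ n, e n * e (n + 1) = e n)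
    {a : R} {n m : ℕ} (hnm : n ≤ m) (ha : a * e n = a) : a * e m = a := by
  induction m, hnm using Nat.le_induction with
  | base => exact ha
  | succ k _ ih => rw [← ih, mul_assoc, he]

/-- Left ideals of a countable von Neumann regular ring are projective. -/
lemma exists_lift_of_countable_regular {R : Type*} [Ring R] [Countable R]
    (hvnr : ∀ a : R, ∃ x : R, a * x * a = a) (J : Ideal R) {X Z : Type*} [AddCommGroup X]
    [Module R X] [AddCommGroup Z] [Module R Z] (p : X →ₗ[R] Z) (hp : Function.Surjective p)
    (ψ : J →ₗ[R] Z) : ∃ k : J →ₗ[R] X, ∀ a, p (k a) = ψ a := by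
  obtain ⟨e, heJ, hidem, he, hJ⟩ := exists_idempotent_sequence hvnr J
  choose y hy using fun n => hp (ψ ⟨e n, heJ n⟩)
  let x : ℕ → X := fun n => Nat.rec (y 0) (fun n z => z + (e (n + 1) - e n) • y (n + 1)) n
  have hx : ∀ n, x (n + 1) = x n + (e (n + 1) - e n) • y (n + 1) := fun n => rfl
  have hpx : ∀ n, p (x n) = ψ ⟨e n, heJ n⟩ := by
    intro n
    induction n with
    | zero => exact hy 0
    | succ n ih =>
      rw [hx, map_add, map_smul, ih, hy, ← map_smul, ← map_add]
      congr 1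
      ext
      simp [sub_mul, hidem, he]
  have hstable : ∀ {a : R} {n m : ℕ}, n ≤ m → a * e n = a → a • x m = a • x n := by
    intro a n m hnm ha
    induction m, hnm using Nat.le_induction with
    | base => rfl
    | succ k hk ih =>
      have h1 := mul_eq_self_of_le he hk ha
      have h2 := mul_eq_self_of_le he (hk.trans k.le_succ) ha
      rw [hx, smul_add, ih, smul_smul, mul_sub, h1, h2, sub_self, zero_smul, add_zero]
  choose N hN using fun a : J => hJ a a.2
  have hNm : ∀ (a : J) {m : ℕ}, N a ≤ m → (a : R) • x (N a) = (a : R) • x m :=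
    fun a m h => (hstable h (hN a)).symm
  refine ⟨{ toFun := fun a => (a : R) • x (N a), map_add' := ?_, map_smul' := ?_ }, ?_⟩
  · intro a b
    rw [hNm a (m := N a + N b + N (a + b)) (by omega),
      hNm b (m := N a + N b + N (a + b)) (by omega),
      hNm (a + b) (m := N a + N b + N (a + b)) (by omega), ← add_smul]
    rfl
  · intro r a
    rw [hNm a (m := N a + N (r • a)) (by omega),
      hNm (r • a) (m := N a + N (r • a)) (by omega), RingHom.id_apply, smul_smul]
    rfl
  · intro a
    change p ((a : R) • x (N a)) = ψ a
    rw [map_smul, hpx, ← map_smul]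
    congr 1
    ext
    exact hN a

/-- Countable von Neumann regular rings are hereditary: quotients of injective modules are
injective. -/
lemma injective_of_surjective_of_countable_regular {R : Type} [Ring R] [Countable R]
    (hvnr : ∀ a : R, ∃ x : R, a * x * a = a) {X Z : Type} [AddCommGroup X]
    [Module R X] [AddCommGroup Z] [Module R Z] [Module.Injective R X] (p : X →ₗ[R] Z)
    (hp : Function.Surjective p) : Module.Injective R Z := by
  refine Module.Baer.injective fun J ψ => ?_
  obtain ⟨k, hk⟩ := exists_lift_of_countable_regular hvnr J p hp ψ
  obtain ⟨k', hk'⟩ := Module.Baer.of_injective (inferInstanceAs (Module.Injective R X)) J k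
  exact ⟨p ∘ₗ k', fun a ha => by rw [LinearMap.comp_apply, hk', hk]⟩

/-- The pullback of `0 → N → X → X/N → 0` along `φ : Y → X/N` splits only if `φ` lifts to `X`. -/
lemma ext1Nonzero_of_not_lift {R : Type} [Ring R] {X Y Z N : Type} [AddCommGroup X] [Module R X]
    [AddCommGroup Y] [Module R Y] [AddCommGroup Z] [Module R Z] [AddCommGroup N] [Module R N]
    (i : N →ₗ[R] X) (hi : Function.Injective i) (p : X →ₗ[R] Z) (hp : Function.Surjective p)
    (hip : LinearMap.range i = LinearMap.ker p) (φ : Y →ₗ[R] Z)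
    (hφ : ¬ ∃ s : Y →ₗ[R] X, p ∘ₗ s = φ) : Ext1Nonzero R Y N := by
  have hpi : ∀ n, p (i n) = 0 := fun n => by
    rw [← LinearMap.mem_ker, ← hip]; exact LinearMap.mem_range_self i n
  let E : Submodule R (X × Y) :=
    LinearMap.ker (p ∘ₗ LinearMap.fst R X Y - φ ∘ₗ LinearMap.snd R X Y)
  have hE : ∀ z : X × Y, z ∈ E ↔ p z.1 = φ z.2 := fun z => by simp [E, sub_eq_zero]
  refine ⟨E, inferInstance, inferInstance,
    (LinearMap.inl R X Y ∘ₗ i).codRestrict E (fun n => (hE _).2 (by simp [hpi])),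
    LinearMap.snd R X Y ∘ₗ E.subtype, ?_, ?_, ?_, ?_⟩
  · intro m n h
    exact hi (congrArg (fun z : E => z.1.1) h)
  · intro y
    obtain ⟨x, hx⟩ := hp (φ y)
    exact ⟨⟨(x, y), (hE _).2 hx⟩, rfl⟩
  · ext ⟨⟨x, y⟩, hz⟩
    rw [hE] at hz
    constructor
    · rintro ⟨n, hn⟩
      exact (congrArg (fun z : E => z.1.2) hn).symm
    · intro h
      have hy : y = 0 := h
      subst hy
      have hx : x ∈ LinearMap.range i := by rw [hip]; simpa using hz
      obtain ⟨n, rfl⟩ := hx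
      exact ⟨n, rfl⟩
  · rintro ⟨s, hs⟩
    refine hφ ⟨LinearMap.fst R X Y ∘ₗ E.subtype ∘ₗ s, ?_⟩
    ext y
    have h1 : ((s y).1).2 = y := LinearMap.congr_fun hs y
    have h2 := (hE _).1 (s y).2
    rw [h1] at h2
    exact h2

/-- Over a countable von Neumann regular ring which is not left Noetherian, an injective module
`Q` containing every cyclic module satisfies `Ext¹(Q, Q^(ℕ)) ≠ 0`. -/
lemma ext1Nonzero_of_countable_regular {R : Type} [Ring R] [Countable R]
    (hvnr : ∀ a : R, ∃ x : R, a * x * a = a) (hnoe : ¬ IsNoetherianRing R)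
    (Q : Type) [AddCommGroup Q] [Module R Q] [Module.Injective R Q]
    (hcyc : ∀ I : Ideal R, ∃ f : (R ⧸ I) →ₗ[R] Q, Function.Injective f) :
    Ext1Nonzero R Q (DirectSum ℕ (fun _ => Q)) := by
  obtain ⟨J, hJ⟩ : ∃ J : Ideal R, ¬ J.FG := by
    by_contra! h
    exact hnoe ((isNoetherianRing_iff_ideal_fg R).2 h)
  obtain ⟨e, heJ, -, he, heq⟩ := exists_idempotent_sequence hvnr J
  choose θ hθ using fun n => hcyc (Ideal.span {e n})
  obtain ⟨ι, hι⟩ := hcyc J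
  let i : DirectSum ℕ (fun _ => Q) →ₗ[R] (ℕ → Q) := DFinsupp.coeFnLinearMap R
  have hi : Function.Injective i := DFunLike.coe_injective
  let p := (LinearMap.range i).mkQ
  have hp : Function.Surjective p := Submodule.mkQ_surjective _
  have hinj : Module.Injective R ((ℕ → Q) ⧸ LinearMap.range i) :=
    injective_of_surjective_of_countable_regular hvnr p hp
  let h : R →ₗ[R] (ℕ → Q) := LinearMap.pi fun n => θ n ∘ₗ (Ideal.span {e n}).mkQ
  have hh0 : ∀ (a : R) (n : ℕ), h a n = 0 ↔ a ∈ Ideal.span {e n} := by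
    intro a n
    change θ n ((Ideal.span {e n}).mkQ a) = 0 ↔ _
    rw [map_eq_zero_iff _ (hθ n), ← LinearMap.mem_ker, Submodule.ker_mkQ]
  have hhJ : J ≤ LinearMap.ker (p ∘ₗ h) := by
    intro a ha
    obtain ⟨n, hn⟩ := heq a ha
    rw [LinearMap.mem_ker, LinearMap.comp_apply, ← LinearMap.mem_ker, Submodule.ker_mkQ]
    refine ⟨DFinsupp.mk (Finset.range n) fun m => h a m, ?_⟩
    ext m
    change (DFinsupp.mk (β := fun _ => Q) (Finset.range n) fun m => h a m) m = h a m
    rw [DFinsupp.mk_apply]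
    split_ifs with hm
    · rfl
    · rw [Finset.mem_range, not_lt] at hm
      exact ((hh0 a m).2 (Ideal.mem_span_singleton'.2 ⟨a, mul_eq_self_of_le he hm hn⟩)).symm
  obtain ⟨φ, hφ⟩ := hinj.out ι hι (J.liftQ (p ∘ₗ h) hhJ)
  refine ext1Nonzero_of_not_lift i hi p hp (Submodule.ker_mkQ _).symm φ ?_
  rintro ⟨s, hs⟩
  have hdiff : h 1 - s (ι (J.mkQ 1)) ∈ LinearMap.range i := by
    rw [← Submodule.ker_mkQ (LinearMap.range i), LinearMap.mem_ker, map_sub, sub_eq_zero]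
    change p (h 1) = (p ∘ₗ s) (ι (J.mkQ 1))
    rw [hs, hφ]
    simp
  obtain ⟨d, hd⟩ := hdiff
  obtain ⟨n, hn⟩ := Infinite.exists_notMem_finset (DFinsupp.finite_support d).toFinset
  have hdn : d n = 0 := by simpa using hn
  refine hJ ?_
  suffices J = Ideal.span {e n} by rw [this]; exact ⟨{e n}, by simp⟩
  refine le_antisymm (fun a ha => (hh0 a n).1 ?_) ?_
  · have h1 : h a = a • h 1 := by rw [← map_smul, smul_eq_mul, mul_one]
    have h2 : a • s (ι (J.mkQ 1)) = 0 := by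
      rw [← map_smul, ← map_smul, ← map_smul, smul_eq_mul, mul_one, Submodule.mkQ_apply,
        (Submodule.Quotient.mk_eq_zero J).2 ha, map_zero, map_zero]
    have h3 : h a = a • i d := by rw [hd, smul_sub, h2, sub_zero, h1]
    rw [h3]
    change a • d n = 0
    rw [hdn, smul_zero]
  · rw [Ideal.span_singleton_le_iff_mem]
    exact heJ n

/-- A ring and its opposite are isomorphic as right modules. -/
def opRightLinearEquiv (A : Type*) [Ring A] : A ≃ₗ[Aᵐᵒᵖ] Aᵐᵒᵖ where
  __ := MulOpposite.opAddEquiv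
  map_smul' _ _ := rfl

/-- **Nonvanishing of `Ext¹` for big injective cogenerators.**
Let `A` be a countable simple von Neumann regular ring which is not right Noetherian, and
let `Q` be an injective cogenerator of the category of right `A`-modules (= `Aᵐᵒᵖ`-modules)
containing an isomorphic copy of every cyclic right `A`-module.  Then
`Ext¹_A(Q, Q^{(ℕ)}) ≠ 0`, where `Q^{(ℕ)}` is the countable direct sum of copies of `Q`. -/
theorem stmt9 (A : Type) [Ring A] [Countable A] [IsSimpleRing A]
    (hvnr : ∀ a : A, ∃ x : A, a * x * a = a)
    (hnoe : ¬ IsNoetherian Aᵐᵒᵖ A)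
    (Q : Type) [AddCommGroup Q] [Module Aᵐᵒᵖ Q]
    (hinj : Module.Injective Aᵐᵒᵖ Q)
    (hcog : ∀ (M : Type) [AddCommGroup M] [Module Aᵐᵒᵖ M],
      ∃ (κ : Type) (f : M →ₗ[Aᵐᵒᵖ] (κ → Q)), Function.Injective f)
    (hcyc : ∀ I : Submodule Aᵐᵒᵖ A, ∃ f : (A ⧸ I) →ₗ[Aᵐᵒᵖ] Q, Function.Injective f) :
    Ext1Nonzero Aᵐᵒᵖ Q (DirectSum ℕ (fun _ => Q)) := by
  have hvnr' : ∀ a : Aᵐᵒᵖ, ∃ x : Aᵐᵒᵖ, a * x * a = a := by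
    intro a
    obtain ⟨x, hx⟩ := hvnr a.unop
    exact ⟨MulOpposite.op x, MulOpposite.unop_injective (by simpa [mul_assoc] using hx)⟩
  have : Countable Aᵐᵒᵖ := MulOpposite.opEquiv.symm.injective.countable
  refine ext1Nonzero_of_countable_regular hvnr' (fun h => hnoe ?_) Q fun I => ?_
  · exact (LinearEquiv.isNoetherian_iff (opRightLinearEquiv A)).2 h
  · let I' : Submodule Aᵐᵒᵖ A := Submodule.comap (opRightLinearEquiv A).toLinearMap I
    obtain ⟨f, hf⟩ := hcyc I'
    let g : (Aᵐᵒᵖ ⧸ I) ≃ₗ[Aᵐᵒᵖ] (A ⧸ I') :=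
      Submodule.Quotient.equiv I I' (opRightLinearEquiv A).symm
        (Submodule.map_equiv_eq_comap_symm _ _)
    exact ⟨f ∘ₗ g.toLinearMap, hf.comp g.injective⟩
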